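/- For the elephant random walk remembering the first two and the most recent step: (S_n − n(2p−1)((X_1+X_2)/2)/(2−p))/√n converges in distribution, as n → ∞, to the mixture of normal laws p·N(0, σ_T²) + (1−p)·N(0, (1+p)/(2−p)), where σ_T² = 1 + (2p−1)(5−5p−p²)/(2−p)³; i.e. the limit distribution function is x ↦ p·Φ_{0,σ_T²}(x) + (1−p)·Φ_{0,(1+p)/(2−p)}(x). -/

import Mathlib

open MeasureTheory ProbabilityTheory Filter Topology

noncomputable section

/-- The σ-algebra generated by the steps `X 1, …, X n`. -/
def sigmaUpTo {Ω : Type*} (X : ℕ → Ω → ℝ) (n : ℕ) : MeasurableSpace Ω :=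
  ⨆ i ∈ Finset.Icc 1 n, MeasurableSpace.comap (X i) inferInstance

/-- The σ-algebra generated by all the steps `X 1, X 2, …`. -/
def sigmaAll {Ω : Type*} (X : ℕ → Ω → ℝ) : MeasurableSpace Ω :=
  ⨆ i ∈ Set.Ici 1, MeasurableSpace.comap (X i) inferInstance

/-- The partial sum `X 1 + ⋯ + X n` of the walk. -/
def partialSum {Ω : Type*} (X : ℕ → Ω → ℝ) (n : ℕ) (ω : Ω) : ℝ :=
  ∑ k ∈ Finset.Icc 1 n, X k ω

/-- Convergence in distribution of the random variables `f n` to the law `ν`,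
expressed as weak convergence tested against bounded continuous functions. -/
def TendstoInDistribution {Ω : Type*} [MeasurableSpace Ω] (μ : Measure Ω)
    (f : ℕ → Ω → ℝ) (ν : Measure ℝ) : Prop :=
  ∀ g : BoundedContinuousFunction ℝ ℝ,
    Tendsto (fun n => ∫ ω, g (f n ω) ∂μ) atTop (𝓝 (∫ x, g x ∂ν))


/-- A conditional expectation may be replaced by a version of it in an integral against a bounded
complex-valued measurable weight. -/
lemma integral_ofReal_mul_eq_of_condExp_ae_eq {Ω : Type*} {m mΩ : MeasurableSpace Ω} (hm : m ≤ mΩ)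
    {μ : Measure Ω} [IsFiniteMeasure μ] {f h : Ω → ℝ} {G : Ω → ℂ} {C : ℝ}
    (hf : Integrable f μ) (hG : StronglyMeasurable[m] G) (hGC : ∀ᵐ ω ∂μ, ‖G ω‖ ≤ C)
    (hc : μ[f | m] =ᵐ[μ] h) :
    ∫ ω, (f ω : ℂ) * G ω ∂μ = ∫ ω, (h ω : ℂ) * G ω ∂μ := by
  have hint : Integrable (f • G) μ := by
    have := hf.ofReal (𝕜 := ℂ) |>.mul_bdd (hG.mono hm).aestronglyMeasurable hGC
    refine this.congr (ae_of_all _ fun ω => ?_)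
    simp
  have h1 := condExp_smul_of_aestronglyMeasurable_right hf hint hG.aestronglyMeasurable
  calc ∫ ω, (f ω : ℂ) * G ω ∂μ = ∫ ω, (f • G) ω ∂μ := by simp
    _ = ∫ ω, (μ[f • G | m]) ω ∂μ := (integral_condExp hm).symm
    _ = ∫ ω, (h ω : ℂ) * G ω ∂μ := by
      refine integral_congr_ae ?_
      filter_upwards [h1, hc] with ω h1 h2
      simp [h1, h2]

/-- Second order expansion of `exp (i s y)` corrected by a factor linear in `y`. -/
lemma norm_exp_mul_corrector_sub_le {s y m k g L : ℝ} (hs : |s| ≤ 1) (hL : 1 ≤ L)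
    (hy : |y| ≤ L) (hm : |m| ≤ L) (hk : |k| ≤ L) (hg : |g| ≤ L) :
    ‖Complex.exp (Complex.I * (s * y)) * (1 + (Complex.I * k * s + g * m * s ^ 2) * y) -
      (1 + Complex.I * s * (1 + k) * y + s ^ 2 * (g * m * y - (k + 1 / 2) * y ^ 2))‖ ≤
      (L ^ 3 * Real.exp L * (1 + 2 * L ^ 3) + 3 * L ^ 5) * |s| ^ 3 := by
  have hL0 : 0 ≤ L := by linarith
  set q : ℂ := 1 + Complex.I * (s * y) + (Complex.I * (s * y)) ^ 2 / 2 with hq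
  set κ : ℂ := Complex.I * k * s + g * m * s ^ 2 with hκ
  have he : ‖Complex.exp (Complex.I * (s * y)) - q‖ ≤ |s| ^ 3 * (L ^ 3 * Real.exp L) := by
    have h := Complex.norm_exp_sub_sum_le_norm_mul_exp (Complex.I * (s * y)) 3
    have hn : ‖Complex.I * ((s : ℂ) * y)‖ = |s| * |y| := by simp
    have hq' : ∑ i ∈ Finset.range 3, (Complex.I * ((s : ℂ) * y)) ^ i / (i.factorial : ℂ) = q := by
      simp [Finset.sum_range_succ, hq, Nat.factorial]
    rw [hq', hn] at h
    refine h.trans ?_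
    rw [mul_pow, mul_assoc]
    have : |s| * |y| ≤ L := by nlinarith [abs_nonneg s, abs_nonneg y]
    gcongr
  have hκn : ‖1 + κ * y‖ ≤ 1 + 2 * L ^ 3 := by
    have h1 : ‖κ‖ ≤ L + L * L := by
      refine (norm_add_le _ _).trans ?_
      simp only [norm_mul, Complex.norm_I, Complex.norm_real, Real.norm_eq_abs, norm_pow, one_mul]
      have : |s| ^ 2 ≤ 1 := by nlinarith [abs_nonneg s]
      have h2 : |k| * |s| ≤ L * 1 := by gcongr
      have h3 : |g| * |m| * |s| ^ 2 ≤ L * L * 1 := by gcongr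
      linarith
    calc ‖1 + κ * y‖ ≤ 1 + ‖κ‖ * |y| := by
          refine (norm_add_le _ _).trans ?_
          simp
      _ ≤ 1 + (L + L * L) * L := by gcongr
      _ ≤ 1 + 2 * L ^ 3 := by nlinarith [mul_nonneg hL0 hL0]
  have hr : q * (1 + κ * y) -
      (1 + Complex.I * s * (1 + k) * y + s ^ 2 * (g * m * y - (k + 1 / 2) * y ^ 2)) =
      s ^ 3 * (Complex.I * g * m * y ^ 2 + -(Complex.I * k * y ^ 3 / 2) +
        -(g * m * s * y ^ 3 / 2)) := by
    rw [hq, hκ]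
    linear_combination (s ^ 2 * y ^ 2 * (k + 1 / 2 + (Complex.I * k * s + g * m * s ^ 2) * y / 2))
      * Complex.I_sq
  have hr' : ‖(Complex.I * g * m * y ^ 2 + -(Complex.I * k * y ^ 3 / 2) +
        -(g * m * s * y ^ 3 / 2) : ℂ)‖ ≤ 3 * L ^ 5 := by
    refine norm_add₃_le.trans ?_
    simp only [norm_neg, norm_div, norm_mul, Complex.norm_I, Complex.norm_real, Real.norm_eq_abs,
      norm_pow, one_mul, Complex.norm_ofNat]
    have h1 : |g| * |m| * |y| ^ 2 ≤ L * L * L ^ 2 := by gcongr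
    have h2 : |k| * |y| ^ 3 ≤ L * L ^ 3 := by gcongr
    have h3 : |g| * |m| * |s| * |y| ^ 3 ≤ L * L * 1 * L ^ 3 := by gcongr
    have h4 : L ^ 4 ≤ L ^ 5 := pow_le_pow_right₀ hL (by norm_num)
    have h5 : 0 ≤ L ^ 4 := by positivity
    nlinarith
  calc _ = ‖(Complex.exp (Complex.I * (s * y)) - q) * (1 + κ * y) + s ^ 3 *
        (Complex.I * g * m * y ^ 2 + -(Complex.I * k * y ^ 3 / 2) +
        -(g * m * s * y ^ 3 / 2))‖ := by rw [← hr]; ring_nf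
    _ ≤ (|s| ^ 3 * (L ^ 3 * Real.exp L)) * (1 + 2 * L ^ 3) + |s| ^ 3 * (3 * L ^ 5) := by
      refine (norm_add_le _ _).trans ?_
      rw [norm_mul, norm_mul, norm_pow, Complex.norm_real, Real.norm_eq_abs]
      gcongr
    _ = _ := by ring

/-- A sequence that is nearly geometric with ratio in the unit disc stays close to the
geometric sequence. -/
lemma norm_sub_geometric_le {w : ℕ → ℂ} {ρ : ℂ} {ε : ℝ} {n₀ : ℕ} (hρ : ‖ρ‖ ≤ 1)
    (hw : ∀ n, n₀ ≤ n → ‖w (n + 1) - ρ * w n‖ ≤ ε) (k : ℕ) :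
    ‖w (n₀ + k) - ρ ^ k * w n₀‖ ≤ k * ε := by
  induction k with
  | zero => simp
  | succ k ih =>
    calc ‖w (n₀ + (k + 1)) - ρ ^ (k + 1) * w n₀‖
        = ‖(w (n₀ + k + 1) - ρ * w (n₀ + k)) + ρ * (w (n₀ + k) - ρ ^ k * w n₀)‖ := by
          rw [← add_assoc]; ring_nf
      _ ≤ ε + 1 * (k * ε) := by
          refine (norm_add_le _ _).trans (add_le_add (hw _ (by lia)) ?_)
          rw [norm_mul]
          gcongr
      _ = (k + 1 : ℕ) * ε := by push_cast; ring

lemma norm_exp_I_mul_ofReal_mul (s r : ℝ) : ‖Complex.exp (Complex.I * (s * r))‖ = 1 := by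
  rw [mul_comm, ← Complex.ofReal_mul, Complex.norm_exp_ofReal_mul_I]

lemma norm_corrector_le {s m k g L : ℝ} (hs : |s| ≤ 1) (hL : 1 ≤ L) (hm : |m| ≤ L)
    (hk : |k| ≤ L) (hg : |g| ≤ L) :
    ‖Complex.I * k * s + g * m * s ^ 2‖ ≤ 2 * L ^ 2 * |s| := by
  have hL0 : 0 ≤ L := by linarith
  refine (norm_add_le _ _).trans ?_
  simp only [norm_mul, Complex.norm_I, Complex.norm_real, Real.norm_eq_abs, norm_pow, one_mul]
  have h1 : |k| * |s| ≤ L * |s| := by gcongr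
  have h2 : |g| * |m| * |s| ^ 2 ≤ L * L * |s| := by
    have : |s| ^ 2 ≤ |s| := by nlinarith [abs_nonneg s]
    gcongr
  have h3 : L * |s| ≤ L * L * |s| := by
    have := abs_nonneg s
    gcongr
    nlinarith
  nlinarith

lemma abs_sub_le_of_eq_one_or_neg_one {a m L : ℝ} (h : a = 1 ∨ a = -1) (hm : |m| ≤ L - 1) :
    |a - m| ≤ L := by
  have ha : |a| = 1 := by rcases h with rfl | rfl <;> simp
  linarith [abs_sub a m]

lemma norm_exp_mul_corrector_le {s r m a k g L : ℝ} (hs : |s| ≤ 1) (hL : 1 ≤ L)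
    (hm : |m| ≤ L - 1) (hk : |k| ≤ L) (hg : |g| ≤ L) (ha : a = 1 ∨ a = -1) :
    ‖Complex.exp (Complex.I * (s * r)) * (1 + (Complex.I * k * s + g * m * s ^ 2) * ↑(a - m))‖ ≤
      1 + 2 * L ^ 3 := by
  rw [norm_mul, norm_exp_I_mul_ofReal_mul, one_mul]
  refine (norm_add_le _ _).trans ?_
  rw [norm_one, norm_mul, Complex.norm_real, Real.norm_eq_abs]
  calc _ ≤ 1 + (2 * L ^ 2 * 1) * L := by
        gcongr
        · exact (norm_corrector_le hs hL (by linarith) hk hg).trans (by gcongr)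
        · exact abs_sub_le_of_eq_one_or_neg_one ha hm
    _ = _ := by ring

lemma aestronglyMeasurable_exp_mul_corrector {Ω : Type*} {mΩ : MeasurableSpace Ω} {μ : Measure Ω}
    {A : Set Ω} {T x M : Ω → ℝ} (k g s : ℝ) (hA : MeasurableSet A) (hT : Measurable T)
    (hx : Measurable x) (hM : Measurable M) :
    AEStronglyMeasurable (A.indicator fun ω => Complex.exp (Complex.I * (s * T ω)) *
      (1 + (Complex.I * k * s + g * M ω * s ^ 2) * ↑(x ω - M ω))) μ :=
  ((by fun_prop : Measurable _).indicator hA).aestronglyMeasurable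

lemma ae_norm_indicator_exp_mul_corrector_le {Ω : Type*} {mΩ : MeasurableSpace Ω} {μ : Measure Ω}
    {T x M : Ω → ℝ} {k g s L : ℝ} (A : Set Ω) (hx1 : ∀ᵐ ω ∂μ, x ω = 1 ∨ x ω = -1)
    (hML : ∀ᵐ ω ∂μ, |M ω| ≤ L - 1) (hs : |s| ≤ 1) (hL : 1 ≤ L) (hk : |k| ≤ L) (hg : |g| ≤ L) :
    ∀ᵐ ω ∂μ, ‖A.indicator (fun ω => Complex.exp (Complex.I * (s * T ω)) *
      (1 + (Complex.I * k * s + g * M ω * s ^ 2) * ↑(x ω - M ω))) ω‖ ≤ 1 + 2 * L ^ 3 := by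
  filter_upwards [hx1, hML] with ω h1 h2
  exact (norm_indicator_le_norm_self _ _).trans (norm_exp_mul_corrector_le hs hL h2 hk hg h1)

lemma integrable_exp_mul_corrector {Ω : Type*} {mΩ : MeasurableSpace Ω} {μ : Measure Ω}
    [IsFiniteMeasure μ] {A : Set Ω} {T x M : Ω → ℝ} {k g s L : ℝ} (hA : MeasurableSet A)
    (hT : Measurable T) (hx : Measurable x) (hM : Measurable M)
    (hx1 : ∀ᵐ ω ∂μ, x ω = 1 ∨ x ω = -1) (hML : ∀ᵐ ω ∂μ, |M ω| ≤ L - 1) (hs : |s| ≤ 1)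
    (hL : 1 ≤ L) (hk : |k| ≤ L) (hg : |g| ≤ L) :
    Integrable (A.indicator fun ω => Complex.exp (Complex.I * (s * T ω)) *
      (1 + (Complex.I * k * s + g * M ω * s ^ 2) * ↑(x ω - M ω))) μ :=
  .of_bound (aestronglyMeasurable_exp_mul_corrector k g s hA hT hx hM) _
    (ae_norm_indicator_exp_mul_corrector_le A hx1 hML hs hL hk hg)

/-- One step of the perturbed characteristic function recursion: the corrector
`1 + (i k s + g M s²) (x - M)` turns the conditional characteristic function of a step into
multiplication by `1 - (1 + 2 k) (1 - v) s² / 2`, up to an error of order `s³`. -/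
lemma norm_integral_corrected_step_sub_le {Ω : Type*} {F mΩ : MeasurableSpace Ω} (hF : F ≤ mΩ)
    {μ : Measure Ω} [IsProbabilityMeasure μ] {A : Set Ω} {T x x' M : Ω → ℝ} {α k g v s L : ℝ}
    (hA : MeasurableSet[F] A) (hT : Measurable[F] T) (hx : Measurable[F] x) (hM : Measurable[F] M)
    (hx'm : Measurable x') (hx1 : ∀ᵐ ω ∂μ, x ω = 1 ∨ x ω = -1)
    (hx'1 : ∀ᵐ ω ∂μ, x' ω = 1 ∨ x' ω = -1) (hML : ∀ᵐ ω ∂μ, |M ω| ≤ L - 1)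
    (hv : ∀ᵐ ω ∂μ, ω ∈ A → M ω ^ 2 = v)
    (hc : μ[x' | F] =ᵐ[μ] fun ω => M ω + α * (x ω - M ω))
    (hk : k = α * (1 + k)) (hg : g = α * (g + 2 * k + 1)) (hs : |s| ≤ 1) (hL : 1 ≤ L)
    (hkL : |k| ≤ L) (hgL : |g| ≤ L) (hvL : |(1 + 2 * k) * (1 - v) / 2| ≤ L) :
    ‖(∫ ω, A.indicator (fun ω => Complex.exp (Complex.I * (s * ↑(T ω + (x' ω - M ω)))) *
          (1 + (Complex.I * k * s + g * M ω * s ^ 2) * ↑(x' ω - M ω))) ω ∂μ) -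
      (1 - (((1 + 2 * k) * (1 - v) / 2 * s ^ 2 : ℝ) : ℂ)) *
        ∫ ω, A.indicator (fun ω => Complex.exp (Complex.I * (s * T ω)) *
          (1 + (Complex.I * k * s + g * M ω * s ^ 2) * ↑(x ω - M ω))) ω ∂μ‖ ≤
      (L ^ 3 * Real.exp L * (1 + 2 * L ^ 3) + 3 * L ^ 5 + 2 * L ^ 4) * |s| ^ 3 := by
  have hL0 : 0 ≤ L := by linarith
  set f₁ : Ω → ℂ := A.indicator (fun ω => Complex.exp (Complex.I * (s * ↑(T ω + (x' ω - M ω)))) *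
          (1 + (Complex.I * k * s + g * M ω * s ^ 2) * ↑(x' ω - M ω))) with hf₁
  set f₂ : Ω → ℂ := A.indicator (fun ω => Complex.exp (Complex.I * (s * T ω)) *
          (1 + (Complex.I * k * s + g * M ω * s ^ 2) * ↑(x ω - M ω))) with hf₂
  set G : Ω → ℂ := A.indicator (fun ω => Complex.exp (Complex.I * (s * T ω)) *
          (Complex.I * s * (1 + k) + s ^ 2 * (M ω * (g + 2 * k + 1)))) with hG
  set θ : ℝ := (1 + 2 * k) * (1 - v) / 2 with hθ
  have hA' := hF _ hA
  have hT' := hT.mono hF le_rfl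
  have hM' := hM.mono hF le_rfl
  have hint₁ : Integrable f₁ μ := integrable_exp_mul_corrector hA'
    (T := fun ω => T ω + (x' ω - M ω)) (by fun_prop) hx'm hM' hx'1 hML hs hL hkL hgL
  have hint₂ : Integrable f₂ μ := integrable_exp_mul_corrector hA' hT' (hx.mono hF le_rfl) hM' hx1
    hML hs hL hkL hgL
  have hGm : StronglyMeasurable[F] G :=
    (Measurable.indicator (by fun_prop) hA).stronglyMeasurable
  have hGb : ∀ᵐ ω ∂μ, ‖G ω‖ ≤ |s| * (1 + |k|) + |s| ^ 2 * (L * |g + 2 * k + 1|) := by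
    filter_upwards [hML] with ω h
    refine (norm_indicator_le_norm_self _ _).trans ?_
    rw [norm_mul, norm_exp_I_mul_ofReal_mul, one_mul]
    refine (norm_add_le _ _).trans ?_
    have h1 : ‖(1 + k : ℂ)‖ ≤ 1 + |k| := (norm_add_le _ _).trans (by simp)
    have h2 : ‖(g + 2 * k + 1 : ℂ)‖ = |g + 2 * k + 1| := by
      rw [← Real.norm_eq_abs, ← Complex.norm_real]; push_cast; rfl
    simp only [norm_mul, Complex.norm_I, Complex.norm_real, Real.norm_eq_abs, norm_pow, one_mul, h2]
    gcongr
    linarith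
  have hx'i : Integrable x' μ := by
    refine .of_bound (C := 1) hx'm.aestronglyMeasurable ?_
    filter_upwards [hx'1] with ω h
    rcases h with h | h <;> simp [h]
  have hhi : Integrable (fun ω => M ω + α * (x ω - M ω)) μ := integrable_condExp.congr hc
  have hGi₁ : Integrable (fun ω => (x' ω : ℂ) * G ω) μ :=
    hx'i.ofReal.mul_bdd (hGm.mono hF).aestronglyMeasurable hGb
  have hGi₂ : Integrable (fun ω => ((M ω + α * (x ω - M ω) : ℝ) : ℂ) * G ω) μ :=
    hhi.ofReal.mul_bdd (hGm.mono hF).aestronglyMeasurable hGb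
  have htr := integral_ofReal_mul_eq_of_condExp_ae_eq hF hx'i hGm hGb hc
  have hsum : (∫ ω, f₁ ω ∂μ) - (1 - ((θ * s ^ 2 : ℝ) : ℂ)) * ∫ ω, f₂ ω ∂μ =
      ∫ ω, (f₁ ω - (1 - ((θ * s ^ 2 : ℝ) : ℂ)) * f₂ ω) -
        ((x' ω : ℂ) * G ω - ((M ω + α * (x ω - M ω) : ℝ) : ℂ) * G ω) ∂μ := by
    have hf₂i := hint₂.const_mul (1 - ((θ * s ^ 2 : ℝ) : ℂ))
    refine Eq.trans ?_ (integral_sub (hint₁.sub hf₂i) (hGi₁.sub hGi₂)).symm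
    simp only [Pi.sub_apply]
    rw [integral_sub hGi₁ hGi₂, htr, integral_sub hint₁ hf₂i, integral_const_mul, sub_self,
      sub_zero]
  rw [hsum]
  refine (norm_integral_le_of_norm_le_const (C := (L ^ 3 * Real.exp L * (1 + 2 * L ^ 3) +
    3 * L ^ 5 + 2 * L ^ 4) * |s| ^ 3) ?_).trans (by simp)
  filter_upwards [hx1, hx'1, hML, hv] with ω h1 h2 h3 h4
  by_cases hω : ω ∈ A
  swap
  · simp only [hf₁, hf₂, hG, Set.indicator_of_notMem hω, mul_zero, sub_zero, norm_zero]
    positivity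
  simp only [hf₁, hf₂, hG, Set.indicator_of_mem hω]
  have h4 := h4 hω
  have hsq : (x' ω - M ω) ^ 2 = 1 - v - 2 * M ω * (x' ω - M ω) := by
    rcases h2 with h | h <;> rw [h, ← h4] <;> ring
  have hmain := norm_exp_mul_corrector_sub_le (s := s) (y := x' ω - M ω) (m := M ω) (k := k)
    (g := g) hs hL (abs_sub_le_of_eq_one_or_neg_one h2 h3) (by linarith) hkL hgL
  have hsq' : ((x' ω - M ω : ℝ) : ℂ) ^ 2 = 1 - v - 2 * M ω * ((x' ω - M ω : ℝ) : ℂ) := by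
    exact_mod_cast congrArg (fun r : ℝ => (r : ℂ)) hsq
  have hk' : (k : ℂ) = α * (1 + k) := by exact_mod_cast hk
  have hg' : (g : ℂ) = α * (g + 2 * k + 1) := by exact_mod_cast hg
  have hsplit : Complex.exp (Complex.I * (s * ↑(T ω + (x' ω - M ω)))) =
      Complex.exp (Complex.I * (s * T ω)) * Complex.exp (Complex.I * (s * ↑(x' ω - M ω))) := by
    rw [← Complex.exp_add]; push_cast; ring_nf
  rw [hsplit]
  have hM2 : |M ω| ≤ L := by linarith
  set e := Complex.exp (Complex.I * (s * T ω))
  set e' := Complex.exp (Complex.I * (s * ↑(x' ω - M ω)))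
  have hrew : e * e' * (1 + (Complex.I * k * s + g * M ω * s ^ 2) * ↑(x' ω - M ω)) -
      (1 - ((θ * s ^ 2 : ℝ) : ℂ)) * (e * (1 + (Complex.I * k * s + g * M ω * s ^ 2) * ↑(x ω - M ω))) -
      (x' ω * (e * (Complex.I * s * (1 + k) + s ^ 2 * (M ω * (g + 2 * k + 1)))) -
        ((M ω + α * (x ω - M ω) : ℝ) : ℂ) *
          (e * (Complex.I * s * (1 + k) + s ^ 2 * (M ω * (g + 2 * k + 1))))) =
      e * ((e' * (1 + (Complex.I * k * s + g * M ω * s ^ 2) * ↑(x' ω - M ω)) -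
        (1 + Complex.I * s * (1 + k) * ↑(x' ω - M ω) + s ^ 2 * (g * M ω * ↑(x' ω - M ω) -
          (k + 1 / 2) * (↑(x' ω - M ω)) ^ 2))) +
        ((θ * s ^ 2 : ℝ) : ℂ) * ((Complex.I * k * s + g * M ω * s ^ 2) * ↑(x ω - M ω))) := by
    rw [hsq', hθ]
    push_cast
    linear_combination (-e * Complex.I * s * (x ω - M ω)) * hk' -
      (e * s ^ 2 * M ω * (x ω - M ω)) * hg'
  rw [hrew, norm_mul, norm_exp_I_mul_ofReal_mul, one_mul]
  refine (norm_add_le _ _).trans ?_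
  have h5 : ‖((θ * s ^ 2 : ℝ) : ℂ) *
      ((Complex.I * k * s + g * M ω * s ^ 2) * ↑(x ω - M ω))‖ ≤
      (L * |s| ^ 2) * (2 * L ^ 2 * |s| * L) := by
    rw [norm_mul, norm_mul, Complex.norm_real, Complex.norm_real, Real.norm_eq_abs,
      Real.norm_eq_abs, abs_mul, abs_pow]
    gcongr
    · exact norm_corrector_le hs hL (by linarith) hkL hgL
    · exact abs_sub_le_of_eq_one_or_neg_one h1 h3
  calc _ ≤ _ := add_le_add hmain h5
    _ = _ := by ring

lemma sigmaUpTo_le {Ω : Type*} [mΩ : MeasurableSpace Ω] {X : ℕ → Ω → ℝ}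
    (hX : ∀ i, Measurable (X i)) (n : ℕ) : sigmaUpTo X n ≤ mΩ :=
  iSup₂_le fun i _ => (hX i).comap_le

lemma measurable_sigmaUpTo {Ω : Type*} (X : ℕ → Ω → ℝ) {i n : ℕ} (hi : 1 ≤ i) (hin : i ≤ n) :
    Measurable[sigmaUpTo X n] (X i) :=
  Measurable.of_comap_le
    (le_iSup₂_of_le (f := fun i (_ : i ∈ Finset.Icc 1 n) => MeasurableSpace.comap (X i) inferInstance)
      i (Finset.mem_Icc.2 ⟨hi, hin⟩) le_rfl)

lemma measurable_partialSum {Ω : Type*} (X : ℕ → Ω → ℝ) (n : ℕ) :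
    Measurable[sigmaUpTo X n] (partialSum X n) :=
  Finset.measurable_fun_sum _ fun _ hi =>
    measurable_sigmaUpTo X (Finset.mem_Icc.1 hi).1 (Finset.mem_Icc.1 hi).2

lemma partialSum_succ {Ω : Type*} (X : ℕ → Ω → ℝ) (n : ℕ) (ω : Ω) :
    partialSum X (n + 1) ω = partialSum X n ω + X (n + 1) ω :=
  Finset.sum_Icc_succ_top (by lia) _

/-- Localized central limit theorem for `±1` steps whose conditional mean regresses with
coefficient `α` towards a random level `M`: on an event where `M ^ 2 = v`, the centred walk is
asymptotically normal with variance `(1 + 2 k) (1 - v)`, where `k = α / (1 - α)`. -/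
lemma tendsto_setIntegral_exp_of_condExp_eq {Ω : Type*} [mΩ : MeasurableSpace Ω]
    {μ : Measure Ω} [IsProbabilityMeasure μ] {X : ℕ → Ω → ℝ} {A : Set Ω} {M : Ω → ℝ}
    {α k v K : ℝ} {n₀ : ℕ} (hX : ∀ i, Measurable (X i)) (hn₀ : 1 ≤ n₀)
    (hval : ∀ i, 1 ≤ i → ∀ᵐ ω ∂μ, X i ω = 1 ∨ X i ω = -1)
    (hA : ∀ n, n₀ ≤ n → MeasurableSet[sigmaUpTo X n] A)
    (hM : ∀ n, n₀ ≤ n → Measurable[sigmaUpTo X n] M)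
    (hMK : ∀ᵐ ω ∂μ, |M ω| ≤ K) (hv : ∀ᵐ ω ∂μ, ω ∈ A → M ω ^ 2 = v)
    (hc : ∀ n, n₀ ≤ n →
      μ[X (n + 1) | sigmaUpTo X n] =ᵐ[μ] fun ω => M ω + α * (X n ω - M ω))
    (hk : k = α * (1 + k)) (hvar : 0 ≤ (1 + 2 * k) * (1 - v)) (t : ℝ) :
    Tendsto (fun n : ℕ => ∫ ω in A,
        Complex.exp (Complex.I * ((t / √n : ℝ) * ↑(partialSum X n ω - n * M ω))) ∂μ)
      atTop (𝓝 (μ.real A * Complex.exp (-((1 + 2 * k) * (1 - v) / 2 * t ^ 2 : ℝ)))) := by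
  set g : ℝ := k * (1 + 2 * k) with hg_def
  have hg : g = α * (g + 2 * k + 1) := by
    rw [hg_def]; linear_combination (1 + 2 * k) * hk
  set θ : ℝ := (1 + 2 * k) * (1 - v) / 2 with hθ
  have hθ0 : 0 ≤ θ := by positivity
  obtain ⟨ω₀, hω₀⟩ := hMK.exists
  have hK0 : 0 ≤ K := (abs_nonneg _).trans hω₀
  set L : ℝ := 1 + K + |k| + |g| + |θ| with hL_def
  have hL : 1 ≤ L := by have := abs_nonneg k; have := abs_nonneg g; have := abs_nonneg θ; linarith
  have hkL : |k| ≤ L := by have := abs_nonneg g; have := abs_nonneg θ; linarith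
  have hgL : |g| ≤ L := by have := abs_nonneg k; have := abs_nonneg θ; linarith
  have hθL : |θ| ≤ L := by have := abs_nonneg k; have := abs_nonneg g; linarith
  have hML : ∀ᵐ ω ∂μ, |M ω| ≤ L - 1 := by
    filter_upwards [hMK] with ω h
    have := abs_nonneg k; have := abs_nonneg g; have := abs_nonneg θ; linarith
  have hMm : Measurable M := (hM n₀ le_rfl).mono (sigmaUpTo_le hX _) le_rfl
  have hAm : MeasurableSet A := sigmaUpTo_le hX _ _ (hA n₀ le_rfl)
  have hSm (n : ℕ) : Measurable (fun ω => partialSum X n ω - n * M ω) :=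
    ((measurable_partialSum X n).mono (sigmaUpTo_le hX _) le_rfl).sub (hMm.const_mul _)
  let f (s : ℝ) (n : ℕ) : Ω → ℂ := A.indicator fun ω =>
    Complex.exp (Complex.I * (s * ↑(partialSum X n ω - n * M ω))) *
      (1 + (Complex.I * k * s + g * M ω * s ^ 2) * ↑(X n ω - M ω))
  set C : ℝ := L ^ 3 * Real.exp L * (1 + 2 * L ^ 3) + 3 * L ^ 5 + 2 * L ^ 4
  have hstep {s : ℝ} (hs : |s| ≤ 1) (n : ℕ) (hn : n₀ ≤ n) :
      ‖(∫ ω, f s (n + 1) ω ∂μ) - (1 - ((θ * s ^ 2 : ℝ) : ℂ)) * ∫ ω, f s n ω ∂μ‖ ≤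
        C * |s| ^ 3 := by
    have h := norm_integral_corrected_step_sub_le (sigmaUpTo_le hX n) (hA n hn)
      (T := fun ω => partialSum X n ω - n * M ω)
      ((measurable_partialSum X n).sub ((hM n hn).const_mul _))
      (measurable_sigmaUpTo X (hn₀.trans hn) le_rfl) (hM n hn) (hX (n + 1))
      (hval n (hn₀.trans hn)) (hval (n + 1) (by lia)) hML hv (hc n hn) hk hg hs hL hkL hgL hθL
    convert! h using 7
    funext ω
    have h1 : partialSum X (n + 1) ω - ((n + 1 : ℕ) : ℝ) * M ω =
        partialSum X n ω - n * M ω + (X (n + 1) ω - M ω) := by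
      rw [partialSum_succ]; push_cast; ring
    rw [h1]
  let s (n : ℕ) : ℝ := t / √n
  have hs0 : Tendsto s atTop (𝓝 0) :=
    tendsto_const_nhds.div_atTop (Real.tendsto_sqrt_atTop.comp tendsto_natCast_atTop_atTop)
  have hs0c : Tendsto (fun n => (s n : ℂ)) atTop (𝓝 0) := by
    simpa [Function.comp_def] using (Complex.continuous_ofReal.tendsto 0).comp hs0
  have hs1 : ∀ᶠ n in atTop, |s n| ≤ 1 := by
    have := hs0.abs
    rw [abs_zero] at this
    exact this.eventually_le_const one_pos
  have hssq {n : ℕ} : s n ^ 2 = t ^ 2 / n := by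
    simp only [s]
    rw [div_pow, Real.sq_sqrt (Nat.cast_nonneg n)]
  have hρ1 : Tendsto (fun n => 1 - ((θ * s n ^ 2 : ℝ) : ℂ)) atTop (𝓝 1) := by
    have : Tendsto (fun n => θ * s n ^ 2) atTop (𝓝 (θ * 0 ^ 2)) := (hs0.pow 2).const_mul θ
    have := (Complex.continuous_ofReal.tendsto _).comp this
    simpa using this.const_sub 1
  have hρpow : Tendsto (fun n => (1 - ((θ * s n ^ 2 : ℝ) : ℂ)) ^ (n - n₀)) atTop
      (𝓝 (Complex.exp (-(θ * t ^ 2 : ℝ)))) := by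
    have h1 := Complex.tendsto_one_add_div_pow_exp (-((θ * t ^ 2 : ℝ) : ℂ))
    have h2 := h1.div (hρ1.pow n₀) (by simp)
    rw [one_pow, div_one] at h2
    refine h2.congr' ?_
    have hne : ∀ᶠ n in atTop, 1 - ((θ * s n ^ 2 : ℝ) : ℂ) ≠ 0 := hρ1.eventually_ne one_ne_zero
    filter_upwards [eventually_ge_atTop n₀, hne] with n hn hne
    have : (1 : ℂ) + -((θ * t ^ 2 : ℝ) : ℂ) / n = 1 - ((θ * s n ^ 2 : ℝ) : ℂ) := by
      rw [hssq]; push_cast; ring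
    simp only [Pi.div_apply]
    rw [this, pow_sub₀ _ hne hn, div_eq_mul_inv]
  have hinit : Tendsto (fun n => ∫ ω, f (s n) n₀ ω ∂μ) atTop (𝓝 (μ.real A)) := by
    have : (μ.real A : ℂ) = ∫ ω, A.indicator (fun _ => (1 : ℂ)) ω ∂μ := by
      rw [integral_indicator hAm]; simp
    rw [this]
    refine tendsto_integral_filter_of_dominated_convergence (fun _ => 1 + 2 * L ^ 3) ?_ ?_
      (integrable_const _) ?_
    · exact .of_forall fun n =>
        aestronglyMeasurable_exp_mul_corrector k g (s n) hAm (hSm n₀) (hX n₀) hMm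
    · filter_upwards [hs1] with n hn
      exact ae_norm_indicator_exp_mul_corrector_le A (hval n₀ hn₀) hML hn hL hkL hgL
    · refine ae_of_all _ fun ω => ?_
      by_cases hω : ω ∈ A
      · simp only [f, Set.indicator_of_mem hω]
        have hcont : Continuous fun z : ℂ =>
            Complex.exp (Complex.I * (z * ↑(partialSum X n₀ ω - n₀ * M ω))) *
              (1 + (Complex.I * k * z + g * M ω * z ^ 2) * ↑(X n₀ ω - M ω)) := by fun_prop
        have := (hcont.tendsto 0).comp hs0c
        simpa [Function.comp_def] using this
      · simp [f, Set.indicator_of_notMem hω]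
  have hrec : Tendsto (fun n => (∫ ω, f (s n) n ω ∂μ) -
      (1 - ((θ * s n ^ 2 : ℝ) : ℂ)) ^ (n - n₀) * ∫ ω, f (s n) n₀ ω ∂μ) atTop (𝓝 0) := by
    have hlim : Tendsto (fun n => C * t ^ 2 * |s n|) atTop (𝓝 0) := by
      simpa using hs0.abs.const_mul (C * t ^ 2)
    refine squeeze_zero_norm' ?_ hlim
    have hθs : ∀ᶠ n in atTop, θ * s n ^ 2 ≤ 1 := by
      have : Tendsto (fun n => θ * s n ^ 2) atTop (𝓝 (θ * 0 ^ 2)) := (hs0.pow 2).const_mul θ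
      exact this.eventually_le_const (by simp)
    filter_upwards [hs1, hθs, eventually_ge_atTop n₀] with n hn hn' hn₀n
    have hρ : ‖1 - ((θ * s n ^ 2 : ℝ) : ℂ)‖ ≤ 1 := by
      rw [← Complex.ofReal_one, ← Complex.ofReal_sub, Complex.norm_real, Real.norm_eq_abs, abs_le]
      constructor <;> nlinarith [mul_nonneg hθ0 (sq_nonneg (s n))]
    have h := norm_sub_geometric_le hρ (w := fun j => ∫ ω, f (s n) j ω ∂μ) (hstep hn) (n - n₀)
    rw [Nat.add_sub_cancel' hn₀n] at h
    have hL0 : 0 ≤ L := by linarith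
    have hC : 0 ≤ C := by positivity
    have hnpos : (0 : ℝ) < n := by exact_mod_cast (by lia : 0 < n)
    calc _ ≤ _ := h
      _ ≤ n * (C * |s n| ^ 3) := by
        gcongr
        lia
      _ = C * (n * s n ^ 2) * |s n| := by rw [← sq_abs]; ring
      _ = C * t ^ 2 * |s n| := by rw [hssq]; field_simp
  have hcorr : Tendsto (fun n => (∫ ω in A,
      Complex.exp (Complex.I * ((s n) * ↑(partialSum X n ω - n * M ω))) ∂μ) -
        ∫ ω, f (s n) n ω ∂μ) atTop (𝓝 0) := by
    have hlim : Tendsto (fun n => 2 * L ^ 3 * |s n|) atTop (𝓝 0) := by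
      simpa using hs0.abs.const_mul (2 * L ^ 3)
    refine squeeze_zero_norm' ?_ hlim
    filter_upwards [hs1, eventually_ge_atTop n₀] with n hn hn₀n
    have hi := integrable_exp_mul_corrector (k := k) (g := g) hAm (hSm n) (hX n) hMm
      (hval n (hn₀.trans hn₀n)) hML hn hL hkL hgL
    have hi' : Integrable (A.indicator fun ω =>
        Complex.exp (Complex.I * ((s n) * ↑(partialSum X n ω - n * M ω)))) μ := by
      refine .of_bound (C := 1) ?_ (ae_of_all _ fun ω => ?_)
      · have := hSm n
        exact ((by fun_prop : Measurable _).indicator hAm).aestronglyMeasurable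
      · exact (norm_indicator_le_norm_self _ _).trans (norm_exp_I_mul_ofReal_mul _ _).le
    rw [← integral_indicator hAm, ← integral_sub hi' hi]
    refine (norm_integral_le_of_norm_le_const (C := 2 * L ^ 3 * |s n|) ?_).trans (by simp)
    filter_upwards [hML, hval n (hn₀.trans hn₀n)] with ω h1 h2
    by_cases hω : ω ∈ A
    · simp only [Set.indicator_of_mem hω]
      rw [mul_add, mul_one, sub_add_cancel_left, norm_neg, norm_mul, norm_exp_I_mul_ofReal_mul,
        one_mul, norm_mul, Complex.norm_real, Real.norm_eq_abs]
      calc _ ≤ (2 * L ^ 2 * |s n|) * L := by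
            gcongr
            · exact norm_corrector_le hn hL (by linarith) hkL hgL
            · exact abs_sub_le_of_eq_one_or_neg_one h2 h1
        _ = _ := by ring
    · simp only [Set.indicator_of_notMem hω, sub_zero, norm_zero]
      have : 0 ≤ L := by linarith
      positivity
  have := (hcorr.add hrec).add (hρpow.mul hinit)
  rw [zero_add, zero_add, mul_comm] at this
  refine this.congr fun n => ?_
  simp only [s]
  ring

/-- The characteristic function of a mixture of two centred Gaussians. -/
lemma charFun_smul_gaussianReal_add {a b : ℝ} (ha : 0 ≤ a) (hb : 0 ≤ b) (u v : NNReal) (t : ℝ) :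
    charFun (ENNReal.ofReal a • gaussianReal 0 u + ENNReal.ofReal b • gaussianReal 0 v) t =
      a * Complex.exp (-(u * t ^ 2 / 2)) + b * Complex.exp (-(v * t ^ 2 / 2)) := by
  have hint (w : NNReal) (c : ℝ) : Integrable (fun x : ℝ => Complex.exp (t * x * Complex.I))
      (ENNReal.ofReal c • gaussianReal 0 w) := by
    refine Integrable.smul_measure (.of_bound (C := 1) ?_ (ae_of_all _ fun x => ?_))
      ENNReal.ofReal_ne_top
    · exact (by fun_prop : Measurable _).aestronglyMeasurable
    · rw [← Complex.ofReal_mul, Complex.norm_exp_ofReal_mul_I]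
  have h (w : NNReal) : ∫ x : ℝ, Complex.exp (t * x * Complex.I) ∂(gaussianReal 0 w) =
      Complex.exp (-(w * t ^ 2 / 2)) := by
    rw [← charFun_apply_real, charFun_gaussianReal]
    simp
  rw [charFun_apply_real, integral_add_measure (hint u a) (hint v b), integral_smul_measure,
    integral_smul_measure, h, h, ENNReal.toReal_ofReal ha, ENNReal.toReal_ofReal hb]
  simp

/-- Lévy's continuity theorem, phrased for random variables on a fixed probability space. -/
lemma tendstoInDistribution_of_tendsto_integral_exp {Ω : Type*} [MeasurableSpace Ω]
    {μ : Measure Ω} [IsProbabilityMeasure μ] {Z : ℕ → Ω → ℝ} (hZ : ∀ n, Measurable (Z n))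
    {ν : Measure ℝ} [IsProbabilityMeasure ν]
    (h : ∀ t : ℝ, Tendsto (fun n => ∫ ω, Complex.exp (t * Z n ω * Complex.I) ∂μ) atTop
      (𝓝 (charFun ν t))) :
    _root_.TendstoInDistribution μ Z ν := by
  let P (n : ℕ) : ProbabilityMeasure ℝ :=
    ⟨μ.map (Z n), Measure.isProbabilityMeasure_map (hZ n).aemeasurable⟩
  have hP : Tendsto P atTop (𝓝 (⟨ν, inferInstance⟩ : ProbabilityMeasure ℝ)) := by
    refine ProbabilityMeasure.tendsto_iff_tendsto_charFun.2 fun t => ?_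
    refine (h t).congr fun n => ?_
    change _ = charFun (μ.map (Z n)) t
    rw [charFun_apply_real, integral_map (hZ n).aemeasurable]
    exact (by fun_prop : Measurable _).aestronglyMeasurable
  intro f
  refine (ProbabilityMeasure.tendsto_iff_forall_integral_tendsto.1 hP f).congr fun n => ?_
  exact integral_map (hZ n).aemeasurable f.continuous.aestronglyMeasurable

/-- If `x, y` are signs and the conditional mean of `y` given a σ-algebra making `x` measurable is
`(2 p - 1) x`, then `y = x` with probability `p`. -/
lemma measureReal_eq_of_condExp_eq {Ω : Type*} {F mΩ : MeasurableSpace Ω} (hF : F ≤ mΩ)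
    {μ : Measure Ω} [IsProbabilityMeasure μ] {x y : Ω → ℝ} {p : ℝ}
    (hx : Measurable[F] x) (hy : Measurable y) (hx1 : ∀ᵐ ω ∂μ, x ω = 1 ∨ x ω = -1)
    (hy1 : ∀ᵐ ω ∂μ, y ω = 1 ∨ y ω = -1)
    (hc : μ[y | F] =ᵐ[μ] fun ω => (2 * p - 1) * x ω) :
    μ.real {ω | x ω = y ω} = p := by
  have hxm := hx.mono hF le_rfl
  have hbound {z : Ω → ℝ} (hz : ∀ᵐ ω ∂μ, z ω = 1 ∨ z ω = -1) : ∀ᵐ ω ∂μ, ‖z ω‖ ≤ 1 := by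
    filter_upwards [hz] with ω h
    rcases h with h | h <;> simp [h]
  have hyi : Integrable y μ := .of_bound hy.aestronglyMeasurable 1 (hbound hy1)
  have hyx : Integrable (fun ω => y ω * x ω) μ := hyi.mul_bdd hxm.aestronglyMeasurable (hbound hx1)
  have hpull := condExp_mul_of_stronglyMeasurable_right hx.stronglyMeasurable hyx hyi
  have hE : ∫ ω, y ω * x ω ∂μ = 2 * p - 1 := by
    calc ∫ ω, y ω * x ω ∂μ = ∫ ω, (μ[y * x | F]) ω ∂μ := (integral_condExp hF).symm
      _ = ∫ _, (2 * p - 1) ∂μ := by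
        refine integral_congr_ae ?_
        filter_upwards [hpull, hc, hx1] with ω h1 h2 h3
        rw [h1, Pi.mul_apply, h2]
        rcases h3 with h | h <;> simp [h]
      _ = 2 * p - 1 := by simp
  have hms : MeasurableSet {ω | x ω = y ω} := measurableSet_eq_fun hxm hy
  calc μ.real {ω | x ω = y ω} = ∫ ω, Set.indicator {ω | x ω = y ω} 1 ω ∂μ :=
        (integral_indicator_one hms).symm
    _ = ∫ ω, (1 + y ω * x ω) / 2 ∂μ := by
      refine integral_congr_ae ?_
      filter_upwards [hx1, hy1] with ω h1 h2
      rcases h1 with h1 | h1 <;> rcases h2 with h2 | h2 <;> norm_num [Set.indicator, h1, h2]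
    _ = p := by
      rw [integral_div, integral_add (integrable_const _) hyx, hE]
      simp

/-- for the elephant random walk remembering the first two and the most
recent step: `(Sₙ - n(2p-1)((X₁+X₂)/2)/(2-p))/√n` converges in distribution to the mixture
`p·N(0, σ_T²) + (1-p)·N(0, (1+p)/(2-p))`, where `σ_T² = 1 + (2p-1)(5-5p-p²)/(2-p)³`. -/
theorem elephant_first_two_and_last_step_clt
    {Ω : Type*} [MeasurableSpace Ω] (μ : Measure Ω) [IsProbabilityMeasure μ]
    (p : ℝ) (hp0 : 0 < p) (hp1 : p < 1)
    (X : ℕ → Ω → ℝ)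
    (hXmeas : ∀ i, Measurable (X i))
    (hval : ∀ i, 1 ≤ i → ∀ᵐ ω ∂μ, X i ω = 1 ∨ X i ω = -1)
    (hinit : μ {ω | X 1 ω = 1} = ENNReal.ofReal p)
    (hcond1 : μ[X 2 | sigmaUpTo X 1] =ᵐ[μ] fun ω => (2*p-1) * X 1 ω)
    (hcond2 : μ[X 3 | sigmaUpTo X 2] =ᵐ[μ] fun ω => (2*p-1) * (X 1 ω + X 2 ω) / 2)
    (hcond : ∀ n, 3 ≤ n →
      μ[X (n+1) | sigmaUpTo X n] =ᵐ[μ]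
        fun ω => (2*p-1) * (X 1 ω + X 2 ω + X n ω) / 3) :
    TendstoInDistribution μ
      (fun n ω =>
        (partialSum X n ω - n*(2*p-1)*((X 1 ω + X 2 ω)/2)/(2-p)) / Real.sqrt n)
      (ENNReal.ofReal p •
          gaussianReal 0 (Real.toNNReal (1 + (2*p-1)*(5-5*p-p^2)/(2-p)^3)) +
        ENNReal.ofReal (1-p) • gaussianReal 0 (Real.toNNReal ((1+p)/(2-p)))) := by
  have hq : 0 < 2 - p := by linarith
  set M : Ω → ℝ := fun ω => (2 * p - 1) * ((X 1 ω + X 2 ω) / 2) / (2 - p) with hM_def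
  set A : Set Ω := {ω | X 1 ω = X 2 ω}
  set k : ℝ := (2 * p - 1) / (2 * (2 - p)) with hk_def
  have hk : k = (2 * p - 1) / 3 * (1 + k) := by rw [hk_def]; field_simp; ring
  have hk1 : 1 + 2 * k = (1 + p) / (2 - p) := by rw [hk_def]; field_simp; ring
  have hA (n : ℕ) (hn : 3 ≤ n) : MeasurableSet[sigmaUpTo X n] A :=
    measurableSet_eq_fun (measurable_sigmaUpTo X le_rfl (by lia))
      (measurable_sigmaUpTo X (by simp) (by lia))
  have hAm : MeasurableSet A := sigmaUpTo_le hXmeas 3 _ (hA 3 le_rfl)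
  have hM (n : ℕ) (hn : 3 ≤ n) : Measurable[sigmaUpTo X n] M := by
    have h1 : Measurable[sigmaUpTo X n] (X 1) := measurable_sigmaUpTo X le_rfl (by lia)
    have h2 : Measurable[sigmaUpTo X n] (X 2) := measurable_sigmaUpTo X (by simp) (by lia)
    exact (((h1.add h2).div_const 2).const_mul (2 * p - 1)).div_const (2 - p)
  have hMm : Measurable M := (hM 3 le_rfl).mono (sigmaUpTo_le hXmeas 3) le_rfl
  have hMK : ∀ᵐ ω ∂μ, |M ω| ≤ 1 := by
    filter_upwards [hval 1 le_rfl, hval 2 (by simp)] with ω h1 h2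
    have hle : |2 * p - 1| ≤ |2 - p| := by rw [abs_of_pos hq, abs_le]; constructor <;> linarith
    have : |(X 1 ω + X 2 ω) / 2| ≤ 1 := by
      rcases h1 with h1 | h1 <;> rcases h2 with h2 | h2 <;> norm_num [h1, h2]
    rw [hM_def]
    simp only
    rw [abs_div, abs_mul, div_le_one (by positivity)]
    nlinarith [abs_nonneg (2 * p - 1)]
  have hc (n : ℕ) (hn : 3 ≤ n) : μ[X (n + 1) | sigmaUpTo X n] =ᵐ[μ]
      fun ω => M ω + (2 * p - 1) / 3 * (X n ω - M ω) := by
    filter_upwards [hcond n hn] with ω h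
    rw [h, hM_def]
    field_simp
    ring
  have hvA : ∀ᵐ ω ∂μ, ω ∈ A → M ω ^ 2 = ((2 * p - 1) / (2 - p)) ^ 2 := by
    filter_upwards [hval 2 (by simp)] with ω h2 hω
    have hω : X 1 ω = X 2 ω := hω
    rcases h2 with h2 | h2 <;> simp only [hM_def, hω, h2] <;> ring
  have hvAc : ∀ᵐ ω ∂μ, ω ∈ Aᶜ → M ω ^ 2 = 0 := by
    filter_upwards [hval 1 le_rfl, hval 2 (by simp)] with ω h1 h2 hω
    have hω : X 1 ω ≠ X 2 ω := hω
    rcases h1 with h1 | h1 <;> rcases h2 with h2 | h2 <;>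
      first | exact absurd (h1.trans h2.symm) hω | simp [hM_def, h1, h2]
  have hσ : (1 + 2 * k) * (1 - ((2 * p - 1) / (2 - p)) ^ 2) =
      1 + (2*p-1)*(5-5*p-p^2)/(2-p)^3 := by
    rw [hk1]; field_simp; ring
  have hσ0 : 0 ≤ (1 + 2 * k) * (1 - ((2 * p - 1) / (2 - p)) ^ 2) := by
    have h : (1 + 2 * k) * (1 - ((2 * p - 1) / (2 - p)) ^ 2) =
        3 * (1 - p) * (1 + p) ^ 2 / (2 - p) ^ 3 := by
      rw [hk1]; field_simp; ring
    rw [h]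
    have : 0 < 1 - p := by linarith
    positivity
  have hτ0 : 0 ≤ (1 + p) / (2 - p) := by positivity
  have hμA : μ.real A = p := measureReal_eq_of_condExp_eq (sigmaUpTo_le hXmeas 1)
    (measurable_sigmaUpTo X le_rfl le_rfl) (hXmeas 2) (hval 1 le_rfl) (hval 2 (by simp)) hcond1
  have hprob : IsProbabilityMeasure (ENNReal.ofReal p •
          gaussianReal 0 (Real.toNNReal (1 + (2*p-1)*(5-5*p-p^2)/(2-p)^3)) +
        ENNReal.ofReal (1-p) • gaussianReal 0 (Real.toNNReal ((1+p)/(2-p)))) := by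
    refine ⟨?_⟩
    simp only [Measure.add_apply, Measure.smul_apply, measure_univ, smul_eq_mul, mul_one]
    rw [← ENNReal.ofReal_add hp0.le (by linarith)]
    simp
  have hSm (n : ℕ) : Measurable (partialSum X n) :=
    (measurable_partialSum X n).mono (sigmaUpTo_le hXmeas n) le_rfl
  refine tendstoInDistribution_of_tendsto_integral_exp (fun n => ?_) fun t => ?_
  · have h1 := hXmeas 1
    have h2 := hXmeas 2
    have h3 := hSm n
    fun_prop
  have hlimA := tendsto_setIntegral_exp_of_condExp_eq hXmeas (by simp) hval hA hM hMK hvA hc hk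
    hσ0 t
  have hlimAc := tendsto_setIntegral_exp_of_condExp_eq hXmeas (by simp) hval
    (fun n hn => (hA n hn).compl) hM hMK hvAc hc hk (by rw [hk1]; simpa using hτ0) t
  have hlim := hlimA.add hlimAc
  rw [charFun_smul_gaussianReal_add hp0.le (by linarith), Real.coe_toNNReal _ (hσ ▸ hσ0),
    Real.coe_toNNReal _ hτ0]
  rw [probReal_compl_eq_one_sub hAm, hμA, hσ, sub_zero, mul_one, hk1] at hlim
  convert! hlim using 1
  · funext n
    rw [integral_add_compl hAm]
    · refine integral_congr_ae (ae_of_all _ fun ω => ?_)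
      simp only [hM_def]
      push_cast
      ring_nf
    · refine .of_bound (C := 1) ?_ (ae_of_all _ fun ω => (norm_exp_I_mul_ofReal_mul _ _).le)
      have := hSm n
      exact (by fun_prop : Measurable _).aestronglyMeasurable
  · push_cast
    ring_nf
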